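/- Suppose M is an ω-categorical structure whose orbit growth function f_M(n) (orbits of Aut(M) on n-subsets) is not bounded above by any polynomial. If M is hereditarily cellular, then M admits a ∅-definable equivalence relation with infinitely many infinite classes, and hence f_M(n) ≥ p(n), the integer partition function, for all n. -/

import Mathlib

universe u

/-- The number of orbits of `G` on `n`-element subsets of `X` (0 if infinite). -/
noncomputable def orbitCountN (G : Type*) [Group G] (X : Type*) [MulAction G X] (n : ℕ) :
    ℕ :=
  letI := Classical.decEq X
  Nat.card (Quot fun s t : {s : Finset X // s.card = n} =>
    ∃ g : G, (Finset.image (fun x => g • x) s.1) = t.1)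

/-- Hereditarily cellular structures, rendered in terms of their automorphism groups:
either the structure is finite, or it admits a cellular-like partition `(K, E₀, E₁)`
(`K` finite and invariant; `E₀, E₁` invariant equivalence relations on the complement of
`K`, `E₁` refining `E₀`; finitely many `E₀`-classes; each `E₀`-class splitting into
infinitely many `E₁`-classes; the pointwise stabilizer of the complement of any union
`Y` of `E₁`-classes inside an `E₀`-class inducing the full symmetric group on `Y/E₁`)
each of whose components (`K`, and each `E₁`-class, with the group induced by the
pointwise stabilizer of the complement) is again hereditarily cellular. -/
inductive HerCell : ∀ (X : Type u), Subgroup (Equiv.Perm X) → Prop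
  | of_finite (X : Type u) (hX : Finite X) (G : Subgroup (Equiv.Perm X)) : HerCell X G
  | of_partition (X : Type u) (G : Subgroup (Equiv.Perm X))
      (K : Set X) (E0 E1 : X → X → Prop)
      (hKfin : K.Finite)
      (hKinv : ∀ g ∈ G, ∀ x ∈ K, (g : Equiv.Perm X) x ∈ K)
      (hE0refl : ∀ x ∉ K, E0 x x) (hE0symm : ∀ x y, E0 x y → E0 y x)
      (hE0trans : ∀ x y z, E0 x y → E0 y z → E0 x z)
      (hE1refl : ∀ x ∉ K, E1 x x) (hE1symm : ∀ x y, E1 x y → E1 y x)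
      (hE1trans : ∀ x y z, E1 x y → E1 y z → E1 x z)
      (hout : ∀ x y, E0 x y → x ∉ K ∧ y ∉ K)
      (hrefines : ∀ x y, E1 x y → E0 x y)
      (hE0inv : ∀ g ∈ G, ∀ x y, E0 x y → E0 ((g : Equiv.Perm X) x) ((g : Equiv.Perm X) y))
      (hE1inv : ∀ g ∈ G, ∀ x y, E1 x y → E1 ((g : Equiv.Perm X) x) ((g : Equiv.Perm X) y))
      (hE0finite : ∃ F : Finset X, ∀ x ∉ K, ∃ y ∈ F, E0 x y)
      (hE1infinite : ∀ x ∉ K, ¬ ∃ F : Finset X, ∀ y, E0 x y → ∃ z ∈ F, E1 y z)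
      (hsym : ∀ Y : Set X, (∀ y ∈ Y, y ∉ K) → (∀ y ∈ Y, ∀ z, E1 y z → z ∈ Y) →
        (∀ y ∈ Y, ∀ z ∈ Y, E0 y z) →
        ∀ π : Equiv.Perm (Quot fun a b : Y => E1 (a : X) (b : X)),
          ∃ g ∈ G, (∀ z ∉ Y, (g : Equiv.Perm X) z = z) ∧
            ∃ hgY : ∀ y ∈ Y, (g : Equiv.Perm X) y ∈ Y,
              ∀ y : Y, Quot.mk _ (⟨(g : Equiv.Perm X) y, hgY _ y.2⟩ : Y) =
                π (Quot.mk _ y))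
      (GK : Subgroup (Equiv.Perm K))
      (hGK : ∀ g : Equiv.Perm K, g ∈ GK ↔ ∃ h ∈ G, (∀ z ∉ K, (h : Equiv.Perm X) z = z) ∧
          ∀ x : K, ((g x : X)) = (h : Equiv.Perm X) x)
      (hKrec : HerCell K GK)
      (GC : ∀ x : X, x ∉ K → Subgroup (Equiv.Perm {y : X // E1 x y}))
      (hGC : ∀ (x : X) (hx : x ∉ K) (g : Equiv.Perm {y : X // E1 x y}), g ∈ GC x hx ↔
          ∃ h ∈ G, (∀ z, ¬ E1 x z → (h : Equiv.Perm X) z = z) ∧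
            ∀ y : {y : X // E1 x y}, ((g y : X)) = (h : Equiv.Perm X) y)
      (hcomprec : ∀ (x : X) (hx : x ∉ K), HerCell {y : X // E1 x y} (GC x hx)) :
      HerCell X G

lemma orb_eq {X : Type u} (G : Subgroup (Equiv.Perm X)) (n : ℕ) :
    orbitCountN G X n = Nat.card (Quot fun s t : {s : Finset X // s.card = n} =>
      ∃ g ∈ G, s.1.map (Equiv.toEmbedding g) = t.1) := by
  unfold orbitCountN
  congr 1
  congr 1
  funext s t
  apply propext
  constructor
  · rintro ⟨g, hg⟩
    refine ⟨g.1, g.2, ?_⟩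
    rw [← hg]
    ext x
    simp only [Finset.mem_map, Finset.mem_image, Subgroup.smul_def]
    rfl
  · rintro ⟨g, hg, h⟩
    refine ⟨⟨g, hg⟩, ?_⟩
    rw [← h]
    ext x
    simp only [Finset.mem_map, Finset.mem_image, Subgroup.smul_def]
    rfl

structure CP {X : Type u} (G : Subgroup (Equiv.Perm X)) (K : Set X)
    (E0 E1 : X → X → Prop) : Prop where
  kfin : K.Finite
  kinv : ∀ g ∈ G, ∀ x ∈ K, (g : Equiv.Perm X) x ∈ K
  r0 : ∀ x ∉ K, E0 x x
  r1 : ∀ x ∉ K, E1 x x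
  s1 : ∀ x y, E1 x y → E1 y x
  t1 : ∀ x y z, E1 x y → E1 y z → E1 x z
  out : ∀ x y, E0 x y → x ∉ K ∧ y ∉ K
  ref : ∀ x y, E1 x y → E0 x y
  inv1 : ∀ g ∈ G, ∀ x y, E1 x y → E1 ((g : Equiv.Perm X) x) ((g : Equiv.Perm X) y)
  fin0 : ∃ F : Finset X, ∀ x ∉ K, ∃ y ∈ F, E0 x y
  inf1 : ∀ x ∉ K, ¬ ∃ F : Finset X, ∀ y, E0 x y → ∃ z ∈ F, E1 y z
  swap : ∀ x y, E0 x y → ∃ g ∈ G, (∀ z, ¬ E1 x z → ¬ E1 y z → (g : Equiv.Perm X) z = z) ∧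
    (∀ z, E1 x z → E1 y (g z)) ∧ (∀ z, E1 y z → E1 x (g z))

namespace CP

variable {X : Type u} {G : Subgroup (Equiv.Perm X)} {K : Set X} {E0 E1 : X → X → Prop}

def H (G : Subgroup (Equiv.Perm X)) (K : Set X) : Subgroup (Equiv.Perm X) where
  carrier := {g | g ∈ G ∧ (∀ x ∈ K, g x = x) ∧ {x | g x ≠ x}.Finite}
  one_mem' := ⟨G.one_mem, by simp, by simp⟩
  mul_mem' := by
    rintro a b ⟨ha, ha2, ha3⟩ ⟨hb, hb2, hb3⟩
    refine ⟨G.mul_mem ha hb, fun x hx => by simp [hb2 x hx, ha2 x hx],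
      (ha3.union hb3).subset ?_⟩
    intro x hx
    by_contra h
    simp only [Set.mem_union, Set.mem_ofPred_eq, not_or, not_not] at h
    apply hx
    simp [h.1, h.2]
  inv_mem' := by
    rintro a ⟨ha, ha2, ha3⟩
    refine ⟨G.inv_mem ha, fun x hx => ?_, ha3.subset ?_⟩
    · rw [Equiv.Perm.inv_eq_iff_eq, ha2 x hx]
    · intro x hx h
      apply hx
      rw [Equiv.Perm.inv_eq_iff_eq, h]

/-- swaps of finite classes lie in `H` -/
lemma swapH (c : CP G K E0 E1) (hf : ∀ x, {y | E1 x y}.Finite) (x y : X) (hxy : E0 x y) :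
    ∃ g ∈ H G K, (∀ z, ¬ E1 x z → ¬ E1 y z → (g : Equiv.Perm X) z = z) ∧
    (∀ z, E1 x z → E1 y (g z)) ∧ (∀ z, E1 y z → E1 x (g z)) := by
  obtain ⟨g, hg, h1, h2, h3⟩ := c.swap x y hxy
  refine ⟨g, ⟨hg, ?_, ?_⟩, h1, h2, h3⟩
  · intro z hz
    apply h1
    · exact fun h => (c.out _ _ (c.ref _ _ h)).2 hz
    · exact fun h => (c.out _ _ (c.ref _ _ h)).2 hz
  · refine ((hf x).union (hf y)).subset ?_
    intro z hz
    by_contra h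
    simp only [Set.mem_union, Set.mem_ofPred_eq, not_or] at h
    exact hz (h1 z h.1 h.2)

lemma fresh (c : CP G K E0 E1) (hf : ∀ x, {y | E1 x y}.Finite) (S P : Finset X)
    (hP : ∀ x ∈ P, ∀ y, E1 x y → y ∈ P) (F : Finset X) :
    (∀ x ∈ F, x ∉ P ∧ x ∉ K) →
    ∃ h ∈ H G K, (∀ x ∈ P, (h : Equiv.Perm X) x = x) ∧ ∀ x ∈ F, h x ∉ S := by
  classical
  induction F using Finset.induction_on with
  | empty => exact fun _ => ⟨1, (H G K).one_mem, by simp, by simp⟩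
  | insert x F hx ih =>
    intro hF
    obtain ⟨h, hh, hhP, hhF⟩ := ih (fun z hz => hF z (Finset.mem_insert_of_mem hz))
    obtain ⟨hxP, hxK⟩ := hF x (Finset.mem_insert_self _ _)
    have hcP : h x ∉ P := fun hc => hxP (by
      have := h.injective (hhP _ hc); rwa [this] at hc)
    have hcK : h x ∉ K := fun hc => hxK (by
      have := h.injective (hh.2.1 _ hc); rwa [this] at hc)
    have := c.inf1 (h x) hcK
    push Not at this
    obtain ⟨y, hy, hD⟩ := this (S ∪ P ∪ F.image h)
    obtain ⟨g, hg, g1, g2, g3⟩ := c.swapH hf _ _ hy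
    refine ⟨g * h, (H G K).mul_mem hg hh, ?_, ?_⟩
    · intro p hp
      rw [Equiv.Perm.mul_apply, hhP p hp]
      apply g1
      · exact fun hE => hcP (hP p hp _ (c.s1 _ _ hE))
      · exact hD p (by simp [hp])
    · intro z hz
      rw [Equiv.Perm.mul_apply]
      by_cases hE : E1 (h x) (h z)
      · intro hS
        exact hD _ (by simp [hS]) (g2 _ hE)
      · have hzx : z ≠ x := by
          rintro rfl
          exact hE (c.r1 _ hcK)
        have hzF : z ∈ F := (Finset.mem_insert.1 hz).resolve_left hzx
        rw [g1 _ hE (hD _ (by simp only [Finset.mem_union, Finset.mem_image]; exact Or.inr ⟨z, hzF, rfl⟩))]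
        exact hhF z hzF

lemma move (c : CP G K E0 E1) (hf : ∀ x, {y | E1 x y}.Finite) (S A B : Finset X)
    (a b : X) (hA : ∀ x ∈ A, E1 a x) (hB : ∀ x ∈ B, E1 b x)
    (hSa : ∀ x ∈ S, ¬ E1 a x) (hSb : ∀ x ∈ S, ¬ E1 b x)
    (u : Equiv.Perm X) (hu : u ∈ H G K) (huA : A.map u.toEmbedding = B) :
    ∃ v ∈ H G K, A.map (Equiv.toEmbedding v) = B ∧ ∀ x ∈ S, v x = x := by
  classical
  set P : Finset X := (hf a).toFinset ∪ (hf b).toFinset with hPdef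
  have memP : ∀ x, x ∈ P ↔ E1 a x ∨ E1 b x := by intro x; simp [hPdef]
  obtain ⟨h, hh, hP, hS⟩ := c.fresh hf S P (by
    intro x hx y hxy
    rw [memP] at hx ⊢
    exact hx.imp (fun q => c.t1 _ _ _ q hxy) (fun q => c.t1 _ _ _ q hxy))
    (hu.2.2.toFinset.filter (fun x => x ∉ P)) (by
      intro x hx
      simp only [Finset.mem_filter, Set.Finite.mem_toFinset, Set.mem_ofPred_eq] at hx
      exact ⟨hx.2, fun hK => hx.1 (hu.2.1 x hK)⟩)
  refine ⟨h * u * h⁻¹, (H G K).mul_mem ((H G K).mul_mem hh hu) ((H G K).inv_mem hh), ?_, ?_⟩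
  · rw [← huA]
    ext z
    simp only [Finset.mem_map, Equiv.coe_toEmbedding, Equiv.Perm.mul_apply]
    have key : ∀ w ∈ A, h (u (h⁻¹ w)) = u w := by
      intro w hw
      have h1 : h⁻¹ w = w := by
        rw [Equiv.Perm.inv_eq_iff_eq, hP w ((memP w).2 (Or.inl (hA w hw)))]
      rw [h1]
      apply hP
      refine (memP _).2 (Or.inr (hB _ ?_))
      rw [← huA]
      exact Finset.mem_map_of_mem _ hw
    constructor
    · rintro ⟨w, hw, rfl⟩
      exact ⟨w, hw, (key w hw).symm⟩
    · rintro ⟨w, hw, rfl⟩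
      exact ⟨w, hw, key w hw⟩
  · intro t ht
    simp only [Equiv.Perm.mul_apply]
    by_cases hm : u (h⁻¹ t) = h⁻¹ t
    · rw [hm]; simp
    · exfalso
      by_cases hp : h⁻¹ t ∈ P
      · have h1 := hP _ hp
        rw [show h (h⁻¹ t) = t by simp] at h1
        rw [← h1, memP] at hp
        rcases hp with hp | hp
        · exact hSa t ht hp
        · exact hSb t ht hp
      · have := hS (h⁻¹ t) (Finset.mem_filter.2 ⟨by rw [Set.Finite.mem_toFinset]; exact hm, hp⟩)
        simp at this
        exact this ht

lemma family (c : CP G K E0 E1) (hf : ∀ x, {y | E1 x y}.Finite) {ι : Type*} (I : Finset ι)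
    (A B : ι → Finset X) (a b : ι → X) :
    (∀ i ∈ I, ∀ x ∈ A i, E1 (a i) x) → (∀ i ∈ I, ∀ x ∈ B i, E1 (b i) x) →
    (∀ i ∈ I, ∀ j ∈ I, i ≠ j → ¬ E1 (a i) (a j)) →
    (∀ i ∈ I, ∀ j ∈ I, i ≠ j → ¬ E1 (b i) (b j)) →
    (∀ i ∈ I, ∃ u ∈ H G K, (A i).map (Equiv.toEmbedding u) = B i) →
    ∃ g ∈ H G K, ∀ i ∈ I, (A i).map (Equiv.toEmbedding g) = B i := by
  classical
  induction I using Finset.induction_on with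
  | empty => exact fun _ _ _ _ _ => ⟨1, (H G K).one_mem, by simp⟩
  | insert i I hi ih =>
    intro hA hB hAd hBd hu
    obtain ⟨g, hg, hgI⟩ := ih
      (fun j hj => hA j (Finset.mem_insert_of_mem hj))
      (fun j hj => hB j (Finset.mem_insert_of_mem hj))
      (fun j hj k hk => hAd j (Finset.mem_insert_of_mem hj) k (Finset.mem_insert_of_mem hk))
      (fun j hj k hk => hBd j (Finset.mem_insert_of_mem hj) k (Finset.mem_insert_of_mem hk))
      (fun j hj => hu j (Finset.mem_insert_of_mem hj))
    obtain ⟨u, huH, hu⟩ := hu i (Finset.mem_insert_self _ _)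
    have ii := Finset.mem_insert_self i I
    obtain ⟨v, hv, hvA, hvS⟩ := c.move hf (I.biUnion B) ((A i).map g.toEmbedding) (B i)
      (g (a i)) (b i)
      (by
        intro x hx
        simp only [Finset.mem_map, Equiv.coe_toEmbedding] at hx
        obtain ⟨w, hw, rfl⟩ := hx
        exact c.inv1 g hg.1 _ _ (hA i ii w hw))
      (hB i ii)
      (by
        intro x hx hE
        obtain ⟨j, hj, hxj⟩ := Finset.mem_biUnion.1 hx
        rw [← hgI j hj] at hxj
        simp only [Finset.mem_map, Equiv.coe_toEmbedding] at hxj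
        obtain ⟨w, hw, rfl⟩ := hxj
        have h1 := c.inv1 _ (G.inv_mem hg.1) _ _ hE
        rw [show ∀ z, g⁻¹ (g z) = z by simp, show ∀ z, g⁻¹ (g z) = z by simp] at h1
        refine hAd i ii j (Finset.mem_insert_of_mem hj) (by rintro rfl; exact hi hj) ?_
        exact c.t1 _ _ _ h1 (c.s1 _ _ (hA j (Finset.mem_insert_of_mem hj) w hw)))
      (by
        intro x hx hE
        obtain ⟨j, hj, hxj⟩ := Finset.mem_biUnion.1 hx
        refine hBd i ii j (Finset.mem_insert_of_mem hj) (by rintro rfl; exact hi hj) ?_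
        exact c.t1 _ _ _ hE (c.s1 _ _ (hB j (Finset.mem_insert_of_mem hj) x hxj)))
      (u * g⁻¹) ((H G K).mul_mem huH ((H G K).inv_mem hg))
      (by
        rw [← hu, Finset.map_map]
        congr 1
        ext w
        simp)
    refine ⟨v * g, (H G K).mul_mem hv hg, ?_⟩
    intro j hj
    rcases Finset.mem_insert.1 hj with rfl | hj
    · rw [← hvA, Finset.map_map]
      congr 1
    · have h1 : ∀ x ∈ B j, v x = x := fun x hx =>
        hvS x (Finset.mem_biUnion.2 ⟨j, hj, hx⟩)
      have h2 : (A j).map (Equiv.toEmbedding (v * g)) = (B j).map v.toEmbedding := by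
        rw [← hgI j hj, Finset.map_map]
        congr 1
      rw [h2]
      ext z
      simp only [Finset.mem_map, Equiv.coe_toEmbedding]
      constructor
      · rintro ⟨w, hw, rfl⟩
        rwa [h1 w hw]
      · intro hz
        exact ⟨z, hz, h1 z hz⟩

open Classical in
/-- the pieces of a finite set -/
noncomputable def pieces (K : Set X) (E1 : X → X → Prop) (S : Finset X) : Finset (Finset X) :=
  (S.filter (fun x => x ∉ K)).image (fun x => S.filter (fun y => E1 x y))

lemma pieces_rep (S : Finset X) (c : CP G K E0 E1) (A : Finset X) (hA : A ∈ pieces K E1 S) :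
    ∃ a, a ∈ S ∧ a ∉ K ∧ ∀ x, x ∈ A ↔ x ∈ S ∧ E1 a x := by
  classical
  unfold pieces at hA
  obtain ⟨a, ha, rfl⟩ := Finset.mem_image.1 hA
  rw [Finset.mem_filter] at ha
  exact ⟨a, ha.1, ha.2, by simp⟩

lemma pieces_cover (S : Finset X) (c : CP G K E0 E1) (x : X) (hx : x ∈ S) (hK : x ∉ K) :
    ∃ A ∈ pieces K E1 S, x ∈ A := by
  classical
  refine ⟨S.filter (fun y => E1 x y), ?_, by simp [hx, c.r1 x hK]⟩
  exact Finset.mem_image.2 ⟨x, by simp [hx, hK], by congr⟩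

lemma exists_rep (c : CP G K E0 E1) (hf : ∀ x, {y | E1 x y}.Finite) :
    ∃ W : Finset X, ∀ A : Finset X, ∀ a, a ∉ K → (∀ x ∈ A, E1 a x) →
      ∃ r ∈ W.powerset, ∃ u ∈ H G K, A.map (Equiv.toEmbedding u) = r := by
  classical
  obtain ⟨F, hF⟩ := c.fin0
  refine ⟨F.biUnion (fun y => (hf y).toFinset), ?_⟩
  intro A a ha hA
  obtain ⟨y, hy, hay⟩ := hF a ha
  obtain ⟨g, hg, -, g2, -⟩ := c.swapH hf a y hay
  refine ⟨_, ?_, g, hg, rfl⟩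
  rw [Finset.mem_powerset]
  intro z hz
  simp only [Finset.mem_map, Equiv.coe_toEmbedding] at hz
  obtain ⟨w, hw, rfl⟩ := hz
  exact Finset.mem_biUnion.2 ⟨y, hy, by simpa using g2 w (hA w hw)⟩

lemma exists_match {α β : Type*} [DecidableEq β] (s t : Finset α) (r : α → β)
    (h : ∀ b, (s.filter (fun x => r x = b)).card = (t.filter (fun x => r x = b)).card) :
    ∃ σ : α → α, (∀ x ∈ s, σ x ∈ t ∧ r (σ x) = r x) ∧
      (∀ x ∈ s, ∀ y ∈ s, σ x = σ y → x = y) ∧ ∀ y ∈ t, ∃ x ∈ s, σ x = y := by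
  classical
  have e : ∀ b, (s.filter (fun x => r x = b)) ≃ (t.filter (fun x => r x = b)) :=
    fun b => Finset.equivOfCardEq (h b)
  let σ : α → α := fun x => if hx : x ∈ s then
    (e (r x) ⟨x, by simp [hx]⟩ : α) else x
  have hσ : ∀ b x (hx : x ∈ s.filter (fun x => r x = b)), σ x = e b ⟨x, hx⟩ := by
    intro b x hx
    obtain ⟨h1, rfl⟩ := Finset.mem_filter.1 hx
    simp [σ, h1]
  have h1 : ∀ x ∈ s, σ x ∈ t ∧ r (σ x) = r x := by
    intro x hx
    rw [hσ (r x) x (by simp [hx])]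
    exact Finset.mem_filter.1 (e (r x) ⟨x, by simp [hx]⟩).2
  refine ⟨σ, h1, ?_, ?_⟩
  · intro x hx y hy hxy
    have hr : r y = r x := by rw [← (h1 y hy).2, ← hxy, (h1 x hx).2]
    rw [hσ (r x) x (by simp [hx]), hσ (r x) y (by simp [hy, hr])] at hxy
    have := (e (r x)).injective (Subtype.ext hxy)
    simpa using this
  · intro y hy
    let z := (e (r y)).symm ⟨y, by simp [hy]⟩
    refine ⟨z, (Finset.mem_filter.1 z.2).1, ?_⟩
    rw [hσ (r y) z z.2]
    simp [z]

lemma merge (c : CP G K E0 E1) (hf : ∀ x, {y | E1 x y}.Finite) (S T : Finset X)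
    (hK : ∀ x ∈ K, x ∈ S ↔ x ∈ T) (σ : Finset X → Finset X)
    (h1 : ∀ A ∈ pieces K E1 S, σ A ∈ pieces K E1 T ∧
      ∃ u ∈ H G K, A.map (Equiv.toEmbedding u) = σ A)
    (h2 : ∀ A ∈ pieces K E1 S, ∀ B ∈ pieces K E1 S, σ A = σ B → A = B)
    (h3 : ∀ B ∈ pieces K E1 T, ∃ A ∈ pieces K E1 S, σ A = B) :
    ∃ g ∈ G, S.map (Equiv.toEmbedding g) = T := by
  classical
  choose a ha using fun A : {A // A ∈ pieces K E1 S} => pieces_rep S c A.1 A.2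
  choose b hb using fun A : {A // A ∈ pieces K E1 S} => pieces_rep T c (σ A.1) (h1 A.1 A.2).1
  obtain ⟨g, hg, hgI⟩ := c.family hf (Finset.univ : Finset {A // A ∈ pieces K E1 S})
    (fun A => A.1) (fun A => σ A.1) a b
    (fun A _ x hx => (((ha A).2.2 x).1 hx).2) (fun A _ x hx => (((hb A).2.2 x).1 hx).2)
    (by
      intro A _ B _ hAB hE
      apply hAB
      apply Subtype.ext
      ext x
      rw [(ha A).2.2, (ha B).2.2]
      exact and_congr_right fun _ => ⟨fun h => c.t1 _ _ _ (c.s1 _ _ hE) h, fun h => c.t1 _ _ _ hE h⟩)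
    (by
      intro A _ B _ hAB hE
      apply hAB
      apply Subtype.ext
      apply h2 _ A.2 _ B.2
      ext x
      rw [(hb A).2.2, (hb B).2.2]
      exact and_congr_right fun _ => ⟨fun h => c.t1 _ _ _ (c.s1 _ _ hE) h, fun h => c.t1 _ _ _ hE h⟩)
    (fun A _ => (h1 A.1 A.2).2)
  refine ⟨g, hg.1, ?_⟩
  ext z
  simp only [Finset.mem_map, Equiv.coe_toEmbedding]
  constructor
  · rintro ⟨w, hw, rfl⟩
    by_cases hwK : w ∈ K
    · rw [hg.2.1 w hwK]
      exact (hK w hwK).1 hw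
    · obtain ⟨A, hA, hwA⟩ := pieces_cover S c w hw hwK
      have h4 := hgI ⟨A, hA⟩ (Finset.mem_univ _)
      refine (((hb ⟨A, hA⟩).2.2 _).1 ?_).1
      rw [← h4]
      exact Finset.mem_map_of_mem _ hwA
  · intro hz
    by_cases hzK : z ∈ K
    · exact ⟨z, (hK z hzK).2 hz, hg.2.1 z hzK⟩
    · obtain ⟨B, hB, hzB⟩ := pieces_cover T c z hz hzK
      obtain ⟨A, hA, rfl⟩ := h3 B hB
      have h4 := hgI ⟨A, hA⟩ (Finset.mem_univ _)
      simp only at h4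
      rw [← h4] at hzB
      simp only [Finset.mem_map, Equiv.coe_toEmbedding] at hzB
      obtain ⟨w, hw, rfl⟩ := hzB
      exact ⟨w, (((ha ⟨A, hA⟩).2.2 _).1 hw).1, rfl⟩

lemma pieces_card (S : Finset X) : (pieces K E1 S).card ≤ S.card := by
  classical
  unfold pieces
  exact Finset.card_image_le.trans (Finset.card_filter_le _ _)

lemma poly (c : CP G K E0 E1) (hf : ∀ x, {y | E1 x y}.Finite) :
    ∃ (C d : ℕ), ∀ n : ℕ, orbitCountN G X n ≤ C * (n + 1) ^ d := by
  classical
  obtain ⟨W, hW⟩ := c.exists_rep hf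
  have hr : ∀ A : Finset X, ∃ r : W.powerset, ∀ a, a ∉ K → (∀ x ∈ A, E1 a x) →
      ∃ u ∈ H G K, A.map (Equiv.toEmbedding u) = r.1 := by
    intro A
    by_cases h : ∃ a, a ∉ K ∧ ∀ x ∈ A, E1 a x
    · obtain ⟨a, ha, hA⟩ := h
      obtain ⟨r, hr, hu⟩ := hW A a ha hA
      exact ⟨⟨r, hr⟩, fun _ _ _ => hu⟩
    · exact ⟨⟨∅, by simp⟩, fun a ha hA => absurd ⟨a, ha, hA⟩ h⟩
  choose r hr using hr
  refine ⟨2 ^ c.kfin.toFinset.card, 2 ^ W.card, fun n => ?_⟩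
  rw [orb_eq]
  let prof : {s : Finset X // s.card = n} → c.kfin.toFinset.powerset × (W.powerset → Fin (n + 1)) :=
    fun S => (⟨c.kfin.toFinset.filter (fun x => x ∈ S.1), by simp⟩,
      fun w => ⟨((pieces K E1 S.1).filter (fun A => r A = w)).card, by
        have h1 := Finset.card_filter_le (pieces K E1 S.1) (fun A => r A = w)
        have h2 := pieces_card (K := K) (E1 := E1) S.1
        have h3 := S.2
        omega⟩)
  have key : ∀ S T, prof S = prof T → ∃ g ∈ G, S.1.map (Equiv.toEmbedding g) = T.1 := by
    intro S T h
    have hk := congrArg (fun p => p.1.1) h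
    have hc := fun w => congrArg (fun p => (p.2 w).1) h
    simp only [prof] at hk hc
    obtain ⟨σ, q1, q2, q3⟩ := exists_match (pieces K E1 S.1) (pieces K E1 T.1) r hc
    refine c.merge hf S.1 T.1 ?_ σ ?_ q2 q3
    · intro x hx
      have := congrArg (fun s => x ∈ s) hk
      simpa [hx] using this
    · intro A hA
      refine ⟨(q1 A hA).1, ?_⟩
      obtain ⟨a, -, ha, haA⟩ := pieces_rep S.1 c A hA
      obtain ⟨b, -, hb, hbB⟩ := pieces_rep T.1 c _ (q1 A hA).1
      obtain ⟨u, hu, huA⟩ := hr A a ha (fun x hx => ((haA x).1 hx).2)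
      obtain ⟨v, hv, hvB⟩ := hr (σ A) b hb (fun x hx => ((hbB x).1 hx).2)
      refine ⟨v⁻¹ * u, (H G K).mul_mem ((H G K).inv_mem hv) hu, ?_⟩
      have e1 : A.map (Equiv.toEmbedding (v⁻¹ * u)) = (A.map u.toEmbedding).map (Equiv.toEmbedding v⁻¹) := by
        rw [Finset.map_map]
        congr 1
      rw [e1, huA, ← (q1 A hA).2, ← hvB, Finset.map_map]
      ext z
      simp
  have hinj : Function.Injective (fun q : Quot (fun s t : {s : Finset X // s.card = n} =>
      ∃ g ∈ G, s.1.map (Equiv.toEmbedding g) = t.1) => prof q.out) := by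
    intro p q h
    rw [← Quot.out_eq p, ← Quot.out_eq q]
    exact Quot.sound (key _ _ h)
  have := Nat.card_le_card_of_injective _ hinj
  refine this.trans (le_of_eq ?_)
  rw [Nat.card_prod, Nat.card_fun, Nat.card_eq_fintype_card, Nat.card_eq_fintype_card,
    Nat.card_eq_fintype_card, Fintype.card_coe, Fintype.card_coe, Fintype.card_fin,
    Finset.card_powerset, Finset.card_powerset]

end CP

lemma partition_le {X : Type u} (G : Subgroup (Equiv.Perm X))
    (homega : ∀ n : ℕ, 0 < orbitCountN G X n) (E : X → X → Prop) (hE : Equivalence E)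
    (hinv : ∀ g ∈ G, ∀ x y, E x y → E ((g : Equiv.Perm X) x) ((g : Equiv.Perm X) y))
    (f : ℕ → X) (hfd : ∀ m n, m ≠ n → ¬ E (f m) (f n))
    (hfi : ∀ n, {y : X | E (f n) y}.Infinite) (n : ℕ) :
    Fintype.card (Nat.Partition n) ≤ orbitCountN G X n := by
  classical
  have hpos := homega n
  rw [orb_eq] at hpos ⊢
  have hfin := (Nat.card_pos_iff.1 hpos).2
  let pc : Finset X → Multiset ℕ := fun S =>
    (S.image (fun x => S.filter (fun y => E x y))).val.map Finset.card
  have hpc : ∀ g ∈ G, ∀ S : Finset X, pc (S.map (Equiv.toEmbedding g)) = pc S := by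
    intro g hg S
    have h1 : (S.map (Equiv.toEmbedding g)).image
        (fun x => (S.map (Equiv.toEmbedding g)).filter (fun y => E x y)) =
        (S.image (fun x => S.filter (fun y => E x y))).map
          (Finset.mapEmbedding (Equiv.toEmbedding g)).toEmbedding := by
      rw [Finset.map_eq_image, Finset.image_image, Finset.map_eq_image, Finset.image_image]
      apply Finset.image_congr
      intro x hx
      ext z
      simp only [Function.comp, Finset.mem_filter, Finset.mem_image, Equiv.coe_toEmbedding,
        RelEmbedding.coe_toEmbedding, Finset.mapEmbedding_apply, Finset.mem_map]
      constructor
      · rintro ⟨⟨w, hw, rfl⟩, h⟩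
        refine ⟨w, ⟨hw, ?_⟩, rfl⟩
        simpa using hinv _ (G.inv_mem hg) _ _ h
      · rintro ⟨w, ⟨hw, h⟩, rfl⟩
        exact ⟨⟨w, hw, rfl⟩, hinv _ hg _ _ h⟩
    simp only [pc]
    rw [h1, Finset.map_val, Multiset.map_map]
    apply Multiset.map_congr rfl
    intro A _
    simp
  have hex : ∀ μ : Nat.Partition n, ∃ S : Finset X, S.card = n ∧ pc S = μ.parts := by
    intro μ
    let l := μ.parts.toList
    have hl : (l : Multiset ℕ) = μ.parts := Multiset.coe_toList _
    let e : ∀ i, ℕ ↪ {y : X | E (f i) y} := fun i => (hfi i).natEmbedding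
    let B : ℕ → Finset X := fun i => (Finset.range (l.getD i 0)).image (fun k => (e i k : X))
    have hBE : ∀ i, ∀ x ∈ B i, E (f i) x := by
      intro i x hx
      obtain ⟨k, -, rfl⟩ := Finset.mem_image.1 hx
      exact (e i k).2
    have hBc : ∀ i, (B i).card = l.getD i 0 := by
      intro i
      rw [Finset.card_image_of_injective, Finset.card_range]
      exact fun a b h => (e i).injective (Subtype.ext h)
    have hBne : ∀ i ∈ Finset.range l.length, (B i).Nonempty := by
      intro i hi
      rw [← Finset.card_pos, hBc]
      have hi' := Finset.mem_range.1 hi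
      rw [List.getD_eq_getElem _ _ hi']
      apply μ.parts_pos
      rw [← hl]
      exact List.getElem_mem hi'
    have hdis : ∀ i j x, x ∈ B i → E (f j) x → i = j := by
      intro i j x hx h
      by_contra hne
      exact hfd i j hne (hE.trans (hBE i x hx) (hE.symm h))
    let S := (Finset.range l.length).biUnion B
    have hfil : ∀ i ∈ Finset.range l.length, ∀ x ∈ B i, S.filter (fun y => E x y) = B i := by
      intro i hi x hx
      ext z
      rw [Finset.mem_filter, Finset.mem_biUnion]
      constructor
      · rintro ⟨⟨j, hj, hz⟩, h⟩
        have : j = i := hdis j i z hz (hE.trans (hBE i x hx) h)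
        rwa [this] at hz
      · intro hz
        exact ⟨⟨i, hi, hz⟩, hE.trans (hE.symm (hBE i x hx)) (hBE i z hz)⟩
    have hBinj : Set.InjOn B (Finset.range l.length) := by
      intro i hi j hj h
      obtain ⟨x, hx⟩ := hBne i hi
      exact hdis i j x hx (hBE j x (h ▸ hx))
    have himg : S.image (fun x => S.filter (fun y => E x y)) = (Finset.range l.length).image B := by
      ext A
      rw [Finset.mem_image, Finset.mem_image]
      constructor
      · rintro ⟨x, hx, rfl⟩
        obtain ⟨i, hi, hxi⟩ := Finset.mem_biUnion.1 hx
        exact ⟨i, hi, (hfil i hi x hxi).symm⟩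
      · rintro ⟨i, hi, rfl⟩
        obtain ⟨x, hx⟩ := hBne i hi
        exact ⟨x, Finset.mem_biUnion.2 ⟨i, hi, hx⟩, hfil i hi x hx⟩
    have hlist : (List.range l.length).map (fun i => l.getD i 0) = l := by
      apply List.ext_getElem
      · simp
      · intro i h1 h2
        simp [h2]
    have hparts : pc S = μ.parts := by
      simp only [pc]
      rw [himg, Finset.image_val_of_injOn hBinj, Multiset.map_map]
      rw [← hl]
      simp only [Function.comp, hBc]
      conv_rhs => rw [← hlist]
      rfl
    refine ⟨S, ?_, hparts⟩
    rw [Finset.card_biUnion, ← μ.parts_sum, ← hl]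
    · simp only [hBc]
      conv_rhs => rw [← hlist]
      rfl
    · intro i hi j hj hij
      rw [Function.onFun, Finset.disjoint_left]
      intro x hx hx'
      exact hij (hdis i j x hx (hBE j x hx'))
  choose S hS hSp using hex
  rw [← Nat.card_eq_fintype_card]
  apply Nat.card_le_card_of_injective (fun μ => Quot.mk _ ⟨S μ, hS μ⟩)
  intro μ ν h
  have h2 := congrArg (Quot.lift (fun s : {s : Finset X // s.card = n} => pc s.1) (by
    rintro s t ⟨g, hg, hst⟩
    rw [← hst, hpc g hg])) h
  simp only [hSp] at h2
  exact Nat.Partition.ext h2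

lemma CP.infinite_case {X : Type u} {G : Subgroup (Equiv.Perm X)} {K : Set X}
    {E0 E1 : X → X → Prop} (c : CP G K E0 E1) (x : X) (hx : {y | E1 x y}.Infinite) :
    ∃ E : X → X → Prop, Equivalence E ∧
      (∀ g ∈ G, ∀ x y, E x y → E ((g : Equiv.Perm X) x) ((g : Equiv.Perm X) y)) ∧
      (∃ f : ℕ → X, (∀ m n, m ≠ n → ¬ E (f m) (f n)) ∧
        ∀ n, {y : X | E (f n) y}.Infinite) := by
  classical
  have hxK : x ∉ K := by
    obtain ⟨y, hy⟩ := hx.nonempty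
    exact (c.out _ _ (c.ref _ _ hy)).1
  have hEq : Equivalence (fun a b => a = b ∨ E1 a b) := by
    refine ⟨fun _ => Or.inl rfl, ?_, ?_⟩
    · rintro a b (rfl | h)
      · exact Or.inl rfl
      · exact Or.inr (c.s1 _ _ h)
    · rintro a b d (rfl | h) (rfl | h')
      · exact Or.inl rfl
      · exact Or.inr h'
      · exact Or.inr h
      · exact Or.inr (c.t1 _ _ _ h h')
  refine ⟨_, hEq, ?_, ?_⟩
  · rintro g hg a b (rfl | h)
    · exact Or.inl rfl
    · exact Or.inr (c.inv1 g hg _ _ h)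
  · let s : Setoid {y // E0 x y} := ⟨fun a b => a.1 = b.1 ∨ E1 a.1 b.1,
      fun a => hEq.refl a.1, fun h => hEq.symm h, fun h h' => hEq.trans h h'⟩
    have hinf : Infinite (Quotient s) := by
      by_contra hn
      rw [not_infinite_iff_finite] at hn
      have := Fintype.ofFinite (Quotient s)
      apply c.inf1 x hxK
      refine ⟨Finset.univ.image (fun q : Quotient s => (q.out : X)), fun y hy => ?_⟩
      refine ⟨((Quotient.mk s ⟨y, hy⟩).out : X), by simp, ?_⟩
      have h1 : s.r (Quotient.mk s ⟨y, hy⟩).out ⟨y, hy⟩ := Quotient.mk_out (s := s) ⟨y, hy⟩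
      rcases h1 with h1 | h1
      · rw [h1]
        exact c.r1 _ (c.out _ _ hy).2
      · exact c.s1 _ _ h1
    let e := Infinite.natEmbedding (Quotient s)
    refine ⟨fun n => ((e n).out : X), ?_, ?_⟩
    · intro m n hmn h
      apply hmn
      apply e.injective
      rw [← Quotient.out_eq (e m), ← Quotient.out_eq (e n)]
      exact Quotient.sound h
    · intro n
      obtain ⟨g, hg, -, g2, -⟩ := c.swap x (e n).out.1 (e n).out.2
      have := hx.image (f := g) g.injective.injOn
      refine this.mono ?_
      rintro _ ⟨z, hz, rfl⟩
      exact Or.inr (g2 z hz)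

/-- Suppose `M` is an ω-categorical structure (here: a permutation group
`G` on a countable set `X` with finitely many orbits on `n`-subsets for each `n`) whose
orbit growth function is not bounded above by any polynomial.  If `M` is hereditarily
cellular, then `M` admits an (invariant, hence ∅-definable) equivalence relation with
infinitely many infinite classes, and hence `f_M(n) ≥ p(n)`, the integer partition
function, for all `n`. -/
theorem stmt12 (X : Type u) [Countable X] (G : Subgroup (Equiv.Perm X))
    (homega : ∀ n : ℕ, 0 < orbitCountN G X n)
    (hnotpoly : ¬ ∃ (C d : ℕ), ∀ n : ℕ, orbitCountN G X n ≤ C * (n + 1) ^ d)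
    (hHC : HerCell X G) :
    (∃ E : X → X → Prop, Equivalence E ∧
      (∀ g ∈ G, ∀ x y, E x y → E ((g : Equiv.Perm X) x) ((g : Equiv.Perm X) y)) ∧
      (∃ f : ℕ → X, (∀ m n, m ≠ n → ¬ E (f m) (f n)) ∧
        ∀ n, {y : X | E (f n) y}.Infinite)) ∧
    ∀ n : ℕ, Fintype.card (Nat.Partition n) ≤ orbitCountN G X n := by
  cases hHC with
  | of_finite _ hX =>
    exfalso
    have h := homega (Nat.card X + 1)
    rw [orb_eq] at h
    obtain ⟨q⟩ := (Nat.card_pos_iff.1 h).1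
    obtain ⟨⟨s, hs⟩, -⟩ := Quot.exists_rep q
    have := Fintype.ofFinite X
    have h2 := Finset.card_le_univ s
    rw [Nat.card_eq_fintype_card] at hs
    omega
  | of_partition _ _ K E0 E1 hKfin hKinv hE0refl hE0symm hE0trans hE1refl hE1symm hE1trans hout
      hrefines hE0inv hE1inv hE0finite hE1infinite hsym GK hGK hKrec GC hGC hcomprec =>
    have c : CP G K E0 E1 := by
      refine ⟨hKfin, hKinv, hE0refl, hE1refl, hE1symm, hE1trans, hout, hrefines, hE1inv,
        hE0finite, hE1infinite, ?_⟩
      intro x y hxy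
      classical
      have hxK := (hout _ _ hxy).1
      have hyK := (hout _ _ hxy).2
      let Y : Set X := {z | E1 x z ∨ E1 y z}
      have hY0 : ∀ z ∈ Y, E0 x z := by
        rintro z (h | h)
        · exact hrefines _ _ h
        · exact hE0trans _ _ _ hxy (hrefines _ _ h)
      let R := fun a b : Y => E1 (a : X) (b : X)
      let qx : Quot R := Quot.mk _ ⟨x, Or.inl (hE1refl x hxK)⟩
      let qy : Quot R := Quot.mk _ ⟨y, Or.inr (hE1refl y hyK)⟩
      have hex : ∀ a b : Y, Quot.mk R a = Quot.mk R b → E1 (a : X) (b : X) := by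
        intro a b h
        have h2 := congrArg (Quot.lift (fun w : Y => E1 (a : X) (w : X)) (by
          intro w w' hw
          exact propext ⟨fun q => hE1trans _ _ _ q hw,
            fun q => hE1trans _ _ _ q (hE1symm _ _ hw)⟩)) h
        simp only at h2
        rw [← h2]
        exact hE1refl _ (hout _ _ (hY0 _ a.2)).2
      obtain ⟨g, hg, g1, hgY, g2⟩ := hsym Y (fun z hz => (hout _ _ (hY0 z hz)).2)
        (by
          rintro z (h | h) w hw
          · exact Or.inl (hE1trans _ _ _ h hw)
          · exact Or.inr (hE1trans _ _ _ h hw))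
        (fun z hz w hw => hE0trans _ _ _ (hE0symm _ _ (hY0 z hz)) (hY0 w hw))
        (Equiv.swap qx qy)
      refine ⟨g, hg, ?_, ?_, ?_⟩
      · intro z h1 h2
        exact g1 z (fun h => h.elim h1 h2)
      · intro z hz
        have h1 := g2 ⟨z, Or.inl hz⟩
        have h2 : Quot.mk R ⟨z, Or.inl hz⟩ = qx := Quot.sound (hE1symm _ _ hz)
        rw [h2, Equiv.swap_apply_left] at h1
        exact hE1symm _ _ (hex _ _ h1)
      · intro z hz
        have h1 := g2 ⟨z, Or.inr hz⟩
        have h2 : Quot.mk R ⟨z, Or.inr hz⟩ = qy := Quot.sound (hE1symm _ _ hz)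
        rw [h2, Equiv.swap_apply_right] at h1
        exact hE1symm _ _ (hex _ _ h1)
    by_cases hf : ∀ x, {y | E1 x y}.Finite
    · exact absurd (c.poly hf) hnotpoly
    · push Not at hf
      obtain ⟨x, hx⟩ := hf
      have h := c.infinite_case x hx
      refine ⟨h, ?_⟩
      obtain ⟨E, hE, hinv, f, hfd, hfi⟩ := h
      exact partition_le G homega E hE hinv f hfd hfi
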